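/- Let S=(I_n,A,B,C,D) be an antistable system of order n with E = I_n, with Gramians X_c, X_o and largest Hankel singular value σ₁, and suppose the pair (E_{σ₁}, A_{σ₁}) (built with γ = σ₁) is singular. Then there exist d ≥ 1 and an orthogonal real n×n matrix U such that U A_{σ₁} Uᵀ = [[Â₁₁, Â₁₂],[0, 0]] (block form with the last d rows zero) with Â₁₁ ∈ ℝ^{(n−d)×(n−d)} invertible; i.e. the block form required for the SVD-based optimal RH∞-approximation can be obtained with V = Uᵀ via a real Schur decomposition of A_{σ₁}. -/

import Mathlib

open Matrix

noncomputable section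

/-- Entrywise complexification of a real matrix. -/
def cplx {ι κ : Type*} (M : Matrix ι κ ℝ) : Matrix ι κ ℂ :=
  M.map fun x => (x : ℂ)

/-- The matrix pair (E, A) is regular: det(sE − A) ≠ 0 for some s ∈ ℂ. -/
def RegularPair {ι : Type*} [Fintype ι] [DecidableEq ι] (E A : Matrix ι ι ℝ) : Prop :=
  ∃ s : ℂ, (s • cplx E - cplx A).det ≠ 0

/-- (E, A) is stable: sE − A is invertible for every s with Re s ≥ 0. -/
def StablePair {ι : Type*} [Fintype ι] [DecidableEq ι] (E A : Matrix ι ι ℝ) : Prop :=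
  ∀ s : ℂ, 0 ≤ s.re → IsUnit (s • cplx E - cplx A)

/-- (E, A) is antistable: E invertible and sE − A invertible for every s with Re s ≤ 0. -/
def AntistablePair {ι : Type*} [Fintype ι] [DecidableEq ι] (E A : Matrix ι ι ℝ) : Prop :=
  IsUnit E ∧ ∀ s : ℂ, s.re ≤ 0 → IsUnit (s • cplx E - cplx A)

/-- Transfer function G(s) = C (sE − A)⁻¹ B + D of the system (E, A, B, C, D). -/
def transfer {ι κm κp : Type*} [Fintype ι] [DecidableEq ι]
    (E A : Matrix ι ι ℝ) (B : Matrix ι κm ℝ) (C : Matrix κp ι ℝ) (D : Matrix κp κm ℝ)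
    (s : ℂ) : Matrix κp κm ℂ :=
  cplx C * (s • cplx E - cplx A)⁻¹ * cplx B + cplx D

/-- Spectral norm (ℓ² operator norm) of a complex matrix. -/
def spec2 {κp κm : Type*} [Fintype κp] [Fintype κm] [DecidableEq κm]
    (M : Matrix κp κm ℂ) : ℝ :=
  ‖LinearMap.toContinuousLinearMap (Matrix.toEuclideanLin M)‖

/-- Squared Frobenius norm of a complex matrix. -/
def frobSq {κp κm : Type*} [Fintype κp] [Fintype κm] (M : Matrix κp κm ℂ) : ℝ :=
  ∑ i, ∑ j, ‖M i j‖ ^ 2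

/-- `Xc`, `Xo` are controllability/observability Gramians of the system (E, A, B, C, ·). -/
def IsGramians {ι κm κp : Type*} [Fintype ι] [Fintype κm] [Fintype κp]
    (E A : Matrix ι ι ℝ) (B : Matrix ι κm ℝ) (C : Matrix κp ι ℝ)
    (Xc Xo : Matrix ι ι ℝ) : Prop :=
  Xc.IsSymm ∧ Xo.IsSymm ∧
    A * Xc * Eᵀ + E * Xc * Aᵀ + B * Bᵀ = 0 ∧
    Aᵀ * Xo * E + Eᵀ * Xo * A + Cᵀ * C = 0

/-- σ₁ ≥ 0 is the largest Hankel singular value: σ₁² is the greatest eigenvalue of XcEᵀXoE. -/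
def IsLargestHSV {ι : Type*} [Fintype ι] [DecidableEq ι]
    (E Xc Xo : Matrix ι ι ℝ) (σ1 : ℝ) : Prop :=
  0 ≤ σ1 ∧ ((σ1 : ℂ) ^ 2) ∈ spectrum ℂ (cplx (Xc * Eᵀ * Xo * E)) ∧
    ∀ μ ∈ spectrum ℂ (cplx (Xc * Eᵀ * Xo * E)), μ.re ≤ σ1 ^ 2

/-- R_γ = XoEXcEᵀ − γ²I. -/
def Rg {ι : Type*} [Fintype ι] [DecidableEq ι] (E Xc Xo : Matrix ι ι ℝ) (γ : ℝ) :
    Matrix ι ι ℝ :=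
  Xo * E * Xc * Eᵀ - γ ^ 2 • (1 : Matrix ι ι ℝ)

/-- E_γ = Eᵀ R_γ. -/
def Eg {ι : Type*} [Fintype ι] [DecidableEq ι] (E Xc Xo : Matrix ι ι ℝ) (γ : ℝ) :
    Matrix ι ι ℝ :=
  Eᵀ * Rg E Xc Xo γ

/-- C_γ = C Xc Eᵀ. -/
def Cg {ι κp : Type*} [Fintype ι] (C : Matrix κp ι ℝ) (E Xc : Matrix ι ι ℝ) :
    Matrix κp ι ℝ :=
  C * Xc * Eᵀ

/-- A_γ = −Aᵀ R_γ − Cᵀ C_γ. -/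
def Ag {ι κp : Type*} [Fintype ι] [Fintype κp] [DecidableEq ι]
    (E A : Matrix ι ι ℝ) (C : Matrix κp ι ℝ) (Xc Xo : Matrix ι ι ℝ) (γ : ℝ) :
    Matrix ι ι ℝ :=
  -(Aᵀ * Rg E Xc Xo γ) - Cᵀ * Cg C E Xc

/-- B_γ = Eᵀ Xo B. -/
def Bg {ι κm : Type*} [Fintype ι] (E Xo : Matrix ι ι ℝ) (B : Matrix ι κm ℝ) :
    Matrix ι κm ℝ :=
  Eᵀ * Xo * B

/-- The point iω on the imaginary axis. -/
def iax (ω : ℝ) : ℂ := (ω : ℂ) * Complex.I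

/-- Canonical equivalence Fin k ⊕ Fin d ≃ Fin n given k + d = n. -/
def finBlockEquiv {k d n : ℕ} (h : k + d = n) : Fin k ⊕ Fin d ≃ Fin n :=
  finSumFinEquiv.trans (finCongr h)

end

noncomputable section

section Discrete

open Filter Topology
open scoped NNReal ENNReal

/-- In a complex Banach algebra, the powers of an element whose spectrum lies in the open unit
disc tend to zero. -/
theorem tendsto_pow_zero_of_spectrum_lt_one {R : Type*} [NormedRing R] [NormedAlgebra ℂ R]
    [CompleteSpace R] (a : R) (ha : ∀ z ∈ spectrum ℂ a, ‖z‖ < 1) :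
    Tendsto (fun k : ℕ => a ^ k) atTop (𝓝 0) := by
  nontriviality R
  have hρ : spectralRadius ℂ a < 1 := by
    simpa using spectrum.spectralRadius_lt_of_forall_lt a (r := 1) fun z hz => by
      simpa [← NNReal.coe_lt_coe] using ha z hz
  obtain ⟨r, hr, hr1⟩ := ENNReal.lt_iff_exists_nnreal_btwn.mp hρ
  have hr1' : (r : ℝ) < 1 := by exact_mod_cast hr1
  have hev := (spectrum.pow_nnnorm_pow_one_div_tendsto_nhds_spectralRadius a).eventually_lt_const hr
  refine squeeze_zero_norm' (a := fun k : ℕ => (r : ℝ) ^ k) ?_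
    (tendsto_pow_atTop_nhds_zero_of_lt_one r.2 hr1')
  filter_upwards [hev, eventually_gt_atTop 0] with k hk hk0
  have hk0' : (0 : ℝ) < k := by exact_mod_cast hk0
  have h1 : ((‖a ^ k‖₊ : ℝ≥0∞)) < (r : ℝ≥0∞) ^ (k : ℝ) := by
    rwa [one_div, ENNReal.rpow_inv_lt_iff hk0'] at hk
  rw [ENNReal.rpow_natCast] at h1
  exact_mod_cast h1.le

attribute [local instance] Matrix.linftyOpNormedRing Matrix.linftyOpNormedAlgebra in
/-- The powers of a complex matrix with all eigenvalues in the open unit disc tend to zero. -/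
theorem Matrix.tendsto_pow_zero_of_spectrum_lt_one {ι : Type*} [Fintype ι] [DecidableEq ι]
    (M : Matrix ι ι ℂ) (hM : ∀ z ∈ spectrum ℂ M, ‖z‖ < 1) :
    Tendsto (fun k : ℕ => M ^ k) atTop (𝓝 0) :=
  _root_.tendsto_pow_zero_of_spectrum_lt_one M hM

end Discrete

section Complexification

theorem cplx_transpose {ι κ : Type*} (M : Matrix ι κ ℝ) : cplx Mᵀ = (cplx M)ᵀ := rfl

variable {ι : Type*} [Fintype ι] [DecidableEq ι]

theorem cplx_eq_mapMatrix (M : Matrix ι ι ℝ) : cplx M = Complex.ofRealHom.mapMatrix M := rfl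

theorem det_cplx (M : Matrix ι ι ℝ) : (cplx M).det = (M.det : ℂ) :=
  (RingHom.map_det Complex.ofRealHom M).symm

theorem isUnit_cplx_iff {M : Matrix ι ι ℝ} : IsUnit (cplx M) ↔ IsUnit M := by
  rw [Matrix.isUnit_iff_isUnit_det, Matrix.isUnit_iff_isUnit_det, det_cplx]
  simp [isUnit_iff_ne_zero]

theorem ofReal_mem_spectrum_cplx {M : Matrix ι ι ℝ} {t : ℝ} (ht : t ∈ spectrum ℝ M) :
    (t : ℂ) ∈ spectrum ℂ (cplx M) := by
  rw [spectrum.mem_iff] at ht ⊢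
  rw [← isUnit_cplx_iff] at ht
  convert ht using 2
  ext i j
  by_cases h : i = j <;> simp [cplx, Matrix.algebraMap_matrix_apply, h]

theorem AntistablePair.transpose {A : Matrix ι ι ℝ} (hA : AntistablePair 1 A) :
    AntistablePair 1 Aᵀ := by
  refine ⟨isUnit_one, fun s hs => ?_⟩
  have h := (Matrix.isUnit_transpose _).mpr (hA.2 s hs)
  simpa [cplx_transpose, ← cplx_transpose 1] using h

theorem AntistablePair.isUnit {A : Matrix ι ι ℝ} (hA : AntistablePair 1 A) : IsUnit A := by
  have h := hA.2 0 le_rfl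
  rw [zero_smul, zero_sub, IsUnit.neg_iff] at h
  exact isUnit_cplx_iff.mp h

theorem AntistablePair.isUnit_smul_one_sub {A : Matrix ι ι ℝ} (hA : AntistablePair 1 A) {s : ℂ}
    (hs : s.re ≤ 0) : IsUnit (s • (1 : Matrix ι ι ℂ) - cplx A) := by
  have h := hA.2 s hs
  rwa [cplx_eq_mapMatrix 1, map_one] at h

/-- The Cayley transform of an antistable matrix has spectrum in the open unit disc. -/
theorem AntistablePair.norm_lt_one_of_mem_spectrum_cayley {A : Matrix ι ι ℝ}
    (hA : AntistablePair 1 A) {T : Matrix ι ι ℝ} (hT : T * (1 + A) = 1) (z : ℂ)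
    (hz : z ∈ spectrum ℂ (cplx (T * (1 - A)))) : ‖z‖ < 1 := by
  by_contra! hz1
  apply hz
  have hT' : cplx T * (1 + cplx A) = 1 := by
    simpa only [cplx_eq_mapMatrix, map_mul, map_add, map_one] using
      congrArg Complex.ofRealHom.mapMatrix hT
  have hTu : IsUnit (cplx T) := (Matrix.isUnit_iff_isUnit_det _).mpr
    (Matrix.isUnit_det_of_right_inverse hT')
  have key : algebraMap ℂ (Matrix ι ι ℂ) z - cplx (T * (1 - A)) =
      cplx T * ((z - 1) • 1 + (z + 1) • cplx A) := by
    have : algebraMap ℂ (Matrix ι ι ℂ) z = z • (cplx T * (1 + cplx A)) := by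
      rw [hT', Algebra.algebraMap_eq_smul_one]
    rw [this]
    simp only [cplx_eq_mapMatrix, map_mul, map_sub, map_one]
    simp only [mul_add, mul_sub, mul_one, mul_smul_comm, sub_smul, add_smul, smul_add, one_smul]
    abel
  change IsUnit _
  rw [key]
  refine hTu.mul ?_
  by_cases h : z + 1 = 0
  · have hz' : z = -1 := eq_neg_of_add_eq_zero_left h
    have h2 : IsUnit (-2 : ℂ) := by norm_num
    subst hz'
    norm_num
    simpa [Algebra.algebraMap_eq_smul_one] using h2.map (algebraMap ℂ (Matrix ι ι ℂ))
  · have hs : ((1 - z) / (1 + z)).re ≤ 0 := by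
      have hn : 1 ≤ Complex.normSq z := by
        rw [Complex.normSq_eq_norm_sq]; nlinarith
      rw [Complex.div_re, ← add_div]
      refine div_nonpos_of_nonpos_of_nonneg ?_ (Complex.normSq_nonneg _)
      rw [Complex.normSq_apply] at hn
      simp
      nlinarith
    have hu := hA.isUnit_smul_one_sub hs
    have hc : IsUnit (-(z + 1)) := (IsUnit.mk0 _ h).neg
    have := (hc.map (algebraMap ℂ (Matrix ι ι ℂ))).mul hu
    convert this using 1
    have h' : 1 + z ≠ 0 := by rwa [add_comm]
    rw [Algebra.algebraMap_eq_smul_one, smul_mul_assoc, one_mul, smul_sub, smul_smul,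
      show -(z + 1) * ((1 - z) / (1 + z)) = z - 1 by field_simp; ring]
    rw [neg_smul, sub_neg_eq_add]

end Complexification

section Lyapunov

open Filter Topology

variable {ι : Type*} [Fintype ι] [DecidableEq ι]

theorem AntistablePair.tendsto_cayley_pow {A : Matrix ι ι ℝ}
    (hA : AntistablePair 1 A) {T : Matrix ι ι ℝ} (hT : T * (1 + A) = 1) :
    Tendsto (fun k : ℕ => (T * (1 - A)) ^ k) atTop (𝓝 0) := by
  have h := Matrix.tendsto_pow_zero_of_spectrum_lt_one _
    (hA.norm_lt_one_of_mem_spectrum_cayley hT)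
  have hre : Continuous fun M : Matrix ι ι ℂ => M.map Complex.re :=
    continuous_id.matrix_map Complex.continuous_re
  have h2 := (hre.tendsto 0).comp h
  convert h2 using 2 with k
  · simp only [Function.comp, cplx_eq_mapMatrix, ← map_pow]
    ext i j
    simp
  · ext i j
    simp

/-- Solutions of a Lyapunov equation with antistable coefficient and positive semidefinite
right-hand side are positive semidefinite. -/
theorem AntistablePair.posSemidef_of_lyapunov {A P W : Matrix ι ι ℝ} (hA : AntistablePair 1 A)
    (hP : P.IsSymm) (hW : W.PosSemidef) (h : A * P + P * Aᵀ = W) : P.PosSemidef := by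
  have hu : IsUnit (1 + A) := by
    have h1 := hA.isUnit_smul_one_sub (s := -1) (by simp)
    rw [← isUnit_cplx_iff, ← IsUnit.neg_iff]
    convert h1 using 1
    rw [cplx_eq_mapMatrix, cplx_eq_mapMatrix, map_add, map_one, neg_one_smul, neg_add']
  obtain ⟨T, hT'⟩ := hu.exists_left_inv
  set F := T * (1 - A) with hF
  have hT2 : (1 + Aᵀ) * Tᵀ = 1 := by
    simpa using congrArg Matrix.transpose hT'
  have hstein : P = F * P * Fᵀ + (2 : ℝ) • (T * W * Tᵀ) := by
    have e1 : P = T * ((1 + A) * P * (1 + Aᵀ)) * Tᵀ := by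
      calc P = (T * (1 + A)) * P * ((1 + Aᵀ) * Tᵀ) := by rw [hT', hT2]; simp
        _ = _ := by simp only [mul_assoc]
    have e2 : F * P * Fᵀ = T * ((1 - A) * P * (1 - Aᵀ)) * Tᵀ := by
      simp [hF, Matrix.transpose_mul, mul_assoc]
    rw [e2]
    conv_lhs => rw [e1]
    rw [← h, two_smul]
    noncomm_ring
  have hTW : (T * W * Tᵀ).PosSemidef := by
    simpa using hW.mul_mul_conjTranspose_same T
  have hle : ∀ k : ℕ, (P - F ^ k * P * (F ^ k)ᵀ).PosSemidef := by
    intro k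
    induction k with
    | zero => simpa using Matrix.PosSemidef.zero
    | succ k ih =>
      have e : P - F ^ (k + 1) * P * (F ^ (k + 1))ᵀ =
          (P - F ^ k * P * (F ^ k)ᵀ) + (2 : ℝ) • (F ^ k * (T * W * Tᵀ) * (F ^ k)ᵀ) := by
        have : F ^ k * P * (F ^ k)ᵀ =
            F ^ k * (F * P * Fᵀ + (2 : ℝ) • (T * W * Tᵀ)) * (F ^ k)ᵀ := by rw [← hstein]
        rw [this, pow_succ, Matrix.transpose_mul]
        simp only [mul_add, add_mul, mul_smul_comm, smul_mul_assoc, mul_assoc]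
        abel
      rw [e]
      refine ih.add (Matrix.PosSemidef.smul ?_ (by norm_num))
      simpa using hTW.mul_mul_conjTranspose_same (F ^ k)
  refine Matrix.PosSemidef.of_dotProduct_mulVec_nonneg 
    (by rwa [Matrix.IsHermitian, Matrix.conjTranspose_eq_transpose_of_trivial])
    fun x => ?_
  have hlim : Tendsto (fun k : ℕ => star x ⬝ᵥ ((P - F ^ k * P * (F ^ k)ᵀ) *ᵥ x)) atTop
      (𝓝 (star x ⬝ᵥ (P *ᵥ x))) := by
    have hc : Continuous fun M : Matrix ι ι ℝ => star x ⬝ᵥ ((P - M * P * Mᵀ) *ᵥ x) := by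
      fun_prop
    have h0 := (hc.tendsto 0).comp (hA.tendsto_cayley_pow hT')
    simp only [zero_mul, sub_zero] at h0
    exact h0
  exact ge_of_tendsto' hlim fun k => (hle k).dotProduct_mulVec_nonneg x

end Lyapunov

section Semidefinite

variable {ι : Type*} [Fintype ι] [DecidableEq ι]

open scoped MatrixOrder Matrix.Norms.L2Operator in
/-- A product of two real positive semidefinite matrices without positive eigenvalues is zero. -/
theorem Matrix.PosSemidef.mul_eq_zero_of_spectrum_nonpos {P Q : Matrix ι ι ℝ} (hP : P.PosSemidef)
    (hQ : Q.PosSemidef) (h : ∀ t ∈ spectrum ℝ (P * Q), t ≤ 0) : P * Q = 0 := by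
  obtain ⟨S, rfl⟩ := CStarAlgebra.nonneg_iff_eq_star_mul_self.mp hP.nonneg
  obtain ⟨T, rfl⟩ := CStarAlgebra.nonneg_iff_eq_star_mul_self.mp hQ.nonneg
  simp only [Matrix.star_eq_conjTranspose] at *
  have hK : ((S * Tᴴ) * (S * Tᴴ)ᴴ).PosSemidef := Matrix.posSemidef_self_mul_conjTranspose _
  have hK0 : (S * Tᴴ) * (S * Tᴴ)ᴴ = 0 := by
    rw [← hK.1.eigenvalues_eq_zero_iff]
    ext i
    by_contra hi
    have hmem : hK.1.eigenvalues i ∈ spectrum ℝ ((S * Tᴴ) * (S * Tᴴ)ᴴ) := by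
      rw [hK.1.spectrum_real_eq_range_eigenvalues]
      exact ⟨i, rfl⟩
    have hmem' : hK.1.eigenvalues i ∈ spectrum ℝ (S * (Tᴴ * T * Sᴴ)) \ {0} := by
      refine ⟨?_, hi⟩
      simpa [Matrix.conjTranspose_mul, mul_assoc] using hmem
    rw [spectrum.nonzero_mul_comm] at hmem'
    have hmem2 : hK.1.eigenvalues i ∈ spectrum ℝ (Tᴴ * T * (Sᴴ * S)) \ {0} := by
      simpa [mul_assoc] using hmem'
    rw [spectrum.nonzero_mul_comm] at hmem2
    exact hi (le_antisymm (h _ hmem2.1) (hK.eigenvalues_nonneg i))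
  have hST : S * Tᴴ = 0 := Matrix.self_mul_conjTranspose_eq_zero.mp hK0
  calc Sᴴ * S * (Tᴴ * T) = Sᴴ * (S * Tᴴ) * T := by simp only [mul_assoc]
    _ = 0 := by rw [hST]; simp

end Semidefinite

section Gramians

variable {ι κm κp : Type*} [Fintype ι] [DecidableEq ι] [Fintype κm] [Fintype κp]

/-- The matrix `Q A P + γ² Aᵀ` built from the (negated) Gramians of an antistable system vanishes
for `γ = 0` if `Q P = 0`. -/
theorem mul_mul_eq_zero_of_gramians {A P Q : Matrix ι ι ℝ} {B : Matrix ι κm ℝ}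
    (hP : P.IsSymm) (hQ : Q.IsSymm) (hc : A * P + P * Aᵀ = B * Bᵀ) (hQP : Q * P = 0) :
    Q * A * P = 0 := by
  have hPQ : P * Q = 0 := by
    simpa [Matrix.transpose_mul, hP.eq, hQ.eq] using congrArg Matrix.transpose hQP
  have hQB : Q * B = 0 := by
    apply Matrix.self_mul_conjTranspose_eq_zero.mp
    calc (Q * B) * (Q * B)ᴴ = Q * (B * Bᵀ) * Q := by
          simp [Matrix.transpose_mul, hQ.eq, Matrix.mul_assoc]
      _ = Q * A * (P * Q) + (Q * P) * Aᵀ * Q := by rw [← hc]; noncomm_ring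
      _ = 0 := by rw [hPQ, hQP]; simp
  calc Q * A * P = Q * (A * P + P * Aᵀ) - (Q * P) * Aᵀ := by noncomm_ring
    _ = 0 := by rw [hc, hQP, ← Matrix.mul_assoc, hQB]; simp

/-- If `P`, `Q` are the (negated) Gramians of an antistable system and `γ ≠ 0`, then zero is a
semisimple eigenvalue of `Q A P + γ² Aᵀ`. -/
theorem mulVec_eq_zero_of_gramians {A P Q : Matrix ι ι ℝ} {B : Matrix ι κm ℝ}
    {C : Matrix κp ι ℝ} (hA : IsUnit A) (hP : P.PosSemidef)
    (hc : A * P + P * Aᵀ = B * Bᵀ) (ho : Aᵀ * Q + Q * A = Cᵀ * C) (hQ : Q.IsSymm)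
    {γ : ℝ} (hγ : γ ≠ 0) (x : ι → ℝ)
    (hx : (Q * A * P + γ ^ 2 • Aᵀ) *ᵥ ((Q * A * P + γ ^ 2 • Aᵀ) *ᵥ x) = 0) :
    (Q * A * P + γ ^ 2 • Aᵀ) *ᵥ x = 0 := by
  have hPs : Pᵀ = P := hP.1
  set H := Q * A * P + γ ^ 2 • Aᵀ with hH
  set y := H *ᵥ x with hy
  set W := (C * P)ᵀ * (C * P) + γ ^ 2 • (B * Bᵀ) with hW
  have hWpsd : W.PosSemidef := by
    refine .add ?_ (.smul ?_ (sq_nonneg γ))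
    · simpa using Matrix.posSemidef_conjTranspose_mul_self (C * P)
    · simpa using Matrix.posSemidef_self_mul_conjTranspose B
  have hdiss : P * H + Hᵀ * P = W := by
    have e : (C * P)ᵀ * (C * P) = P * (Cᵀ * C) * P := by
      simp [Matrix.transpose_mul, hPs, Matrix.mul_assoc]
    rw [hW, e, ← hc, ← ho, hH]
    simp only [Matrix.transpose_add, Matrix.transpose_mul, Matrix.transpose_smul,
      Matrix.transpose_transpose, hPs, hQ.eq, mul_add, add_mul, mul_smul_comm, smul_mul_assoc,
      smul_add, mul_assoc]
    abel
  have hWy : W *ᵥ y = 0 := by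
    rw [← hWpsd.dotProduct_mulVec_zero_iff, ← hdiss, Matrix.add_mulVec, ← Matrix.mulVec_mulVec,
      hx, ← Matrix.mulVec_mulVec, star_trivial, Matrix.mulVec_zero, zero_add,
      Matrix.mulVec_transpose, dotProduct_comm, ← Matrix.dotProduct_mulVec, hx, dotProduct_zero]
  have hHPy : Hᵀ *ᵥ (P *ᵥ y) = 0 := by
    rw [← hdiss, Matrix.add_mulVec, ← Matrix.mulVec_mulVec, hx, Matrix.mulVec_zero, zero_add,
      ← Matrix.mulVec_mulVec] at hWy
    exact hWy
  have hPy : P *ᵥ y = 0 := by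
    rw [← hP.dotProduct_mulVec_zero_iff, star_trivial]
    nth_rewrite 1 [hy]
    rw [dotProduct_comm, Matrix.dotProduct_mulVec, ← Matrix.mulVec_transpose, hHPy,
      zero_dotProduct]
  have hAy : Aᵀ *ᵥ y = 0 := by
    rw [hH, Matrix.add_mulVec, ← Matrix.mulVec_mulVec, hPy, Matrix.mulVec_zero, zero_add,
      Matrix.smul_mulVec] at hx
    exact (smul_eq_zero.mp hx).resolve_left (pow_ne_zero 2 hγ)
  exact Matrix.mulVec_injective_of_isUnit ((Matrix.isUnit_transpose A).mpr hA)
    (hAy.trans (Matrix.mulVec_zero _).symm)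

end Gramians

section BlockForm

open Module

/-- A subspace of a finite-dimensional inner product space admits an adapted orthonormal basis. -/
theorem Submodule.exists_orthonormalBasis_sum {E : Type*} [NormedAddCommGroup E]
    [InnerProductSpace ℝ E] [FiniteDimensional ℝ E] (V : Submodule ℝ E) {d : ℕ}
    (hd : finrank ℝ E = finrank ℝ V + d) :
    ∃ b : OrthonormalBasis (Fin (finrank ℝ V) ⊕ Fin d) ℝ E,
      (∀ i, b (Sum.inl i) ∈ V) ∧ ∀ i, ∀ x ∈ V, inner ℝ (b (Sum.inr i)) x = 0 := by
  obtain ⟨c⟩ : Nonempty (OrthonormalBasis (Fin (finrank ℝ V)) ℝ V) := ⟨stdOrthonormalBasis ℝ V⟩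
  have hv : Orthonormal ℝ ((Set.range Sum.inl).domRestrict
      (Sum.elim (fun i => (c i : E)) (0 : Fin d → E))) := by
    have hc := c.orthonormal.comp_linearIsometry V.subtypeₗᵢ
    refine ⟨?_, ?_⟩
    · rintro ⟨_, i, rfl⟩
      simpa using hc.1 i
    · rintro ⟨_, i, rfl⟩ ⟨_, j, rfl⟩ hij
      exact hc.2 fun h => hij (by rw [h])
  obtain ⟨b, hb⟩ := hv.exists_orthonormalBasis_extension_of_card_eq (by simp [hd])
  have hbl : ∀ i, b (Sum.inl i) = c i := fun i => hb _ ⟨i, rfl⟩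
  refine ⟨b, fun i => hbl i ▸ (c i).2, fun i x hx => ?_⟩
  have hx' : x = ∑ j, c.repr ⟨x, hx⟩ j • b (Sum.inl j) := by
    simpa [hbl] using (congrArg Subtype.val (c.sum_repr ⟨x, hx⟩)).symm
  rw [hx', inner_sum]
  refine Finset.sum_eq_zero fun j _ => ?_
  rw [inner_smul_right, b.inner_eq_zero (by simp), mul_zero]

theorem OrthonormalBasis.of_mul_transpose_self {ι κ : Type*} [Fintype ι] [DecidableEq ι]
    [Fintype κ] (b : OrthonormalBasis ι ℝ (EuclideanSpace ℝ κ)) :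
    (Matrix.of fun i j => b i j) * (Matrix.of fun i j => b i j)ᵀ = 1 := by
  ext i j
  have h := b.inner_eq_ite i j
  rw [PiLp.inner_apply] at h
  simpa [Matrix.mul_apply, Matrix.one_apply, mul_comm] using h

theorem OrthonormalBasis.of_mul_mul_transpose_apply {ι κ : Type*} [Fintype ι]
    [Fintype κ] [DecidableEq κ] (b : OrthonormalBasis ι ℝ (EuclideanSpace ℝ κ))
    (H : Matrix κ κ ℝ) (i j : ι) :
    ((Matrix.of fun i j => b i j) * H * (Matrix.of fun i j => b i j)ᵀ) i j =
      inner ℝ (b i) (Matrix.toEuclideanLin H (b j)) := by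
  rw [Matrix.mul_assoc, Matrix.mul_apply, PiLp.inner_apply]
  refine Finset.sum_congr rfl fun l _ => ?_
  simp [Matrix.mul_apply, Matrix.mulVec, dotProduct, mul_comm]

/-- A singular real matrix with semisimple eigenvalue zero is orthogonally similar to a block
matrix whose lower blocks vanish and whose upper left block is invertible. -/
theorem exists_orthogonal_block_form {n : ℕ} (H : Matrix (Fin n) (Fin n) ℝ) (hH : ¬ IsUnit H)
    (hss : ∀ x, H *ᵥ (H *ᵥ x) = 0 → H *ᵥ x = 0) :
    ∃ (k d : ℕ) (_ : 1 ≤ d) (hn : k + d = n) (U : Matrix (Fin n) (Fin n) ℝ)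
      (A11 : Matrix (Fin k) (Fin k) ℝ) (A12 : Matrix (Fin k) (Fin d) ℝ),
      Uᵀ * U = 1 ∧ IsUnit A11 ∧
      U * H * Uᵀ =
        Matrix.reindex (finBlockEquiv hn) (finBlockEquiv hn)
          (Matrix.fromBlocks A11 A12 0 0) := by
  obtain ⟨T, hTdef⟩ : ∃ T, T = Matrix.toEuclideanLin H := ⟨_, rfl⟩
  have hT : ∀ x, T x = WithLp.toLp 2 (H *ᵥ x.ofLp) := fun x => by rw [hTdef]; rfl
  have hss' : ∀ x ∈ LinearMap.range T, T x = 0 → x = 0 := by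
    rintro _ ⟨w, rfl⟩ h
    have := hss w.ofLp (by simpa [hT] using h)
    simp [hT, this]
  have hkn : finrank ℝ (LinearMap.range T) < n := by
    refine lt_of_le_of_ne (by simpa using (LinearMap.range T).finrank_le) fun h => hH ?_
    have hV : LinearMap.range T = ⊤ := Submodule.eq_top_of_finrank_eq (by simpa using h)
    rw [← Matrix.mulVec_surjective_iff_isUnit]
    intro y
    obtain ⟨w, hw⟩ := LinearMap.range_eq_top.mp hV (WithLp.toLp 2 y)
    exact ⟨w.ofLp, by simpa [hT] using hw⟩
  obtain ⟨d, hd⟩ := Nat.exists_eq_add_of_lt hkn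
  have hn : finrank ℝ (LinearMap.range T) + (d + 1) = n := by omega
  obtain ⟨b, hbl, hbr⟩ := (LinearMap.range T).exists_orthonormalBasis_sum (d := d + 1)
    (by simp [hn])
  generalize finrank ℝ (LinearMap.range T) = k at b hn hbl hbr
  clear hkn hd
  obtain ⟨U, hU⟩ : ∃ U : Matrix (Fin k ⊕ Fin (d + 1)) (Fin n) ℝ,
      U = Matrix.of fun i j => b i j := ⟨_, rfl⟩
  have hUU : U * Uᵀ = 1 := hU ▸ b.of_mul_transpose_self
  have hentry : ∀ i j, (U * H * Uᵀ) i j = inner ℝ (b i) (T (b j)) := fun i j => by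
    rw [hU, hTdef, b.of_mul_mul_transpose_apply]
  have hblock : U * H * Uᵀ = Matrix.fromBlocks (U * H * Uᵀ).toBlocks₁₁
      (U * H * Uᵀ).toBlocks₁₂ 0 0 := by
    conv_lhs => rw [← Matrix.fromBlocks_toBlocks (U * H * Uᵀ)]
    congr 1 <;> ext i j <;>
      exact (hentry _ _).trans (hbr _ _ (LinearMap.mem_range_self T _))
  refine ⟨k, d + 1, by omega, hn, U.submatrix (finBlockEquiv hn).symm id,
    (U * H * Uᵀ).toBlocks₁₁, (U * H * Uᵀ).toBlocks₁₂, ?_, ?_, ?_⟩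
  · rw [mul_eq_one_comm]
    change (U * Uᵀ).submatrix (finBlockEquiv hn).symm (finBlockEquiv hn).symm = 1
    rw [hUU, Matrix.submatrix_one_equiv]
  · rw [← Matrix.mulVec_injective_iff_isUnit, ← Matrix.coe_mulVecLin, injective_iff_map_eq_zero]
    intro z hz
    obtain ⟨x, hx⟩ : ∃ x, x = ∑ j, z j • b (Sum.inl j) := ⟨_, rfl⟩
    have hxV : x ∈ LinearMap.range T :=
      hx ▸ Submodule.sum_mem _ fun j _ => Submodule.smul_mem _ _ (hbl j)
    have hTx : T x = 0 := by
      rw [← b.sum_repr' (T x)]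
      refine Finset.sum_eq_zero fun i _ => ?_
      rcases i with i | i
      · have h : ∑ j, inner ℝ (b (Sum.inl i)) (T (b (Sum.inl j))) * z j = 0 := by
          simp only [← hentry]
          exact congrFun hz i
        rw [hx, map_sum, inner_sum]
        simp_rw [map_smul, inner_smul_right]
        simp_rw [mul_comm (z _), h, zero_smul]
      · rw [hbr _ _ (LinearMap.mem_range_self T x), zero_smul]
    ext j
    have h : inner ℝ (b (Sum.inl j)) x = z j := by
      simp [hx, inner_sum, inner_smul_right, b.inner_eq_ite]
    rw [← h, hss' x hxV hTx, inner_zero_right]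
    rfl
  · rw [← hblock]
    rfl

end BlockForm

theorem stmt18 {n m p : ℕ}
    (A : Matrix (Fin n) (Fin n) ℝ) (B : Matrix (Fin n) (Fin m) ℝ)
    (C : Matrix (Fin p) (Fin n) ℝ) (D : Matrix (Fin p) (Fin m) ℝ)
    (hanti : AntistablePair (1 : Matrix (Fin n) (Fin n) ℝ) A)
    (Xc Xo : Matrix (Fin n) (Fin n) ℝ)
    (hX : IsGramians (1 : Matrix (Fin n) (Fin n) ℝ) A B C Xc Xo)
    (σ1 : ℝ) (hσ : IsLargestHSV (1 : Matrix (Fin n) (Fin n) ℝ) Xc Xo σ1)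
    (hsing : ¬ RegularPair (Eg (1 : Matrix (Fin n) (Fin n) ℝ) Xc Xo σ1)
      (Ag (1 : Matrix (Fin n) (Fin n) ℝ) A C Xc Xo σ1)) :
    ∃ (k d : ℕ) (_ : 1 ≤ d) (hn : k + d = n) (U : Matrix (Fin n) (Fin n) ℝ)
      (A11 : Matrix (Fin k) (Fin k) ℝ) (A12 : Matrix (Fin k) (Fin d) ℝ),
      Uᵀ * U = 1 ∧ IsUnit A11 ∧
      U * Ag (1 : Matrix (Fin n) (Fin n) ℝ) A C Xc Xo σ1 * Uᵀ =
        Matrix.reindex (finBlockEquiv hn) (finBlockEquiv hn)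
          (Matrix.fromBlocks A11 A12 0 0) := by
  obtain ⟨hXc, hXo, hc, ho⟩ := hX
  simp only [Matrix.transpose_one, Matrix.mul_one, Matrix.one_mul] at hc ho
  have hP : (-Xc).IsSymm := hXc.neg
  have hQ : (-Xo).IsSymm := hXo.neg
  have hc' : A * -Xc + -Xc * Aᵀ = B * Bᵀ := by
    rw [mul_neg, neg_mul, ← neg_add]
    exact neg_eq_of_add_eq_zero_right hc
  have ho' : Aᵀ * -Xo + -Xo * A = Cᵀ * C := by
    rw [mul_neg, neg_mul, ← neg_add]
    exact neg_eq_of_add_eq_zero_right ho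
  have hPpsd : (-Xc).PosSemidef := hanti.posSemidef_of_lyapunov hP
    (by simpa using Matrix.posSemidef_self_mul_conjTranspose B) hc'
  have hQpsd : (-Xo).PosSemidef := hanti.transpose.posSemidef_of_lyapunov hQ
    (by simpa using Matrix.posSemidef_conjTranspose_mul_self C) (by simpa using ho')
  have hAg : Ag (1 : Matrix (Fin n) (Fin n) ℝ) A C Xc Xo σ1 =
      -Xo * A * -Xc + σ1 ^ 2 • Aᵀ := by
    have : Cᵀ * C * Xc = -(Aᵀ * Xo * Xc) - Xo * A * Xc := by
      rw [← ho']; noncomm_ring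
    simp only [Ag, Rg, Cg, Matrix.transpose_one, Matrix.mul_one, ← Matrix.mul_assoc, this,
      mul_sub, mul_smul_comm]
    noncomm_ring
  refine exists_orthogonal_block_form _ (fun hu => hsing ⟨0, ?_⟩) fun x hx => ?_
  · rw [zero_smul, zero_sub, ← isUnit_iff_ne_zero, ← Matrix.isUnit_iff_isUnit_det, IsUnit.neg_iff]
    exact isUnit_cplx_iff.mpr hu
  · rw [hAg] at hx ⊢
    by_cases h0 : σ1 = 0
    · have hPQ : -Xc * -Xo = 0 := by
        refine hPpsd.mul_eq_zero_of_spectrum_nonpos hQpsd fun t ht => ?_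
        have := hσ.2.2 t (by simpa using ofReal_mem_spectrum_cplx ht)
        simpa [h0] using this
      have hQP : -Xo * -Xc = 0 := by
        simpa [Matrix.transpose_mul, hXc.eq, hXo.eq] using congrArg Matrix.transpose hPQ
      rw [mul_mul_eq_zero_of_gramians hP hQ hc' hQP, h0]
      simp
    · exact mulVec_eq_zero_of_gramians hanti.isUnit hPpsd hc' ho' hQ h0 x hx

end
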